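/- arXiv:math/0701571 — 5 statements merged into one kernel-verified Lean document; each statement's English description precedes it below -/
import Mathlib

section
/- Let S_1, S_2, S_3 be real symmetric 3×3 matrices, let C be an invertible real 3×3 matrix with entries C_{lα}, and define S'_l = Σ_{α=1}^3 C_{lα} S_α for l = 1, 2, 3. Set v_{αβ} = V(S_α S_β − S_β S_α) and v'_{αβ} = V(S'_α S'_β − S'_β S'_α) for α, β = 1, 2, 3. Then det(v'_{23}, v'_{31}, v'_{12}) = (det C)² · det(v_{23}, v_{31}, v_{12}). Consequently, the sign of det(v_{23}, v_{31}, v_{12}) is unchanged under such a change of basis. -/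
open Matrix

/-- The isomorphism `V` between real skew-symmetric `3 × 3` matrices and `ℝ³`,
sending the matrix with rows `(0, a₁₂, −a₃₁), (−a₁₂, 0, a₂₃), (a₃₁, −a₂₃, 0)`
to `(a₂₃, a₃₁, a₁₂)ᵀ`. -/
def Vmap (A : Matrix (Fin 3) (Fin 3) ℝ) : Fin 3 → ℝ := ![A 1 2, A 2 0, A 0 1]

/-- If `S'_l = Σ_α C_{lα} S_α` with `C` invertible, then with
`v_{αβ} = V([S_α, S_β])` and `v'_{αβ} = V([S'_α, S'_β])` one has
`det(v'₂₃, v'₃₁, v'₁₂) = (det C)² · det(v₂₃, v₃₁, v₁₂)`; in particular the sign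
of this determinant is unchanged. -/
theorem stmt_14 (S : Fin 3 → Matrix (Fin 3) (Fin 3) ℝ) (hS : ∀ l, (S l).IsSymm)
    (C : Matrix (Fin 3) (Fin 3) ℝ) (hC : IsUnit C.det)
    (S' : Fin 3 → Matrix (Fin 3) (Fin 3) ℝ)
    (hS' : ∀ l, S' l = ∑ α, C l α • S α)
    (v v' : Fin 3 → Fin 3 → Fin 3 → ℝ)
    (hv : ∀ α β, v α β = Vmap (S α * S β - S β * S α))
    (hv' : ∀ α β, v' α β = Vmap (S' α * S' β - S' β * S' α)) :
    ((Matrix.of ![v' 1 2, v' 2 0, v' 0 1])ᵀ).det =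
      C.det ^ 2 * ((Matrix.of ![v 1 2, v 2 0, v 0 1])ᵀ).det ∧
    Real.sign (((Matrix.of ![v' 1 2, v' 2 0, v' 0 1])ᵀ).det) =
      Real.sign (((Matrix.of ![v 1 2, v 2 0, v 0 1])ᵀ).det) := by
  have key : Matrix.of ![v' 1 2, v' 2 0, v' 0 1] =
      (C.adjugate)ᵀ * Matrix.of ![v 1 2, v 2 0, v 0 1] := by
    rw [Matrix.adjugate_fin_three]
    ext i j
    fin_cases i <;> fin_cases j <;>
      simp [hv, hv', hS', Vmap, Matrix.mul_apply, Fin.sum_univ_three] <;> ring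
  have h1 : ((Matrix.of ![v' 1 2, v' 2 0, v' 0 1])ᵀ).det =
      C.det ^ 2 * ((Matrix.of ![v 1 2, v 2 0, v 0 1])ᵀ).det := by
    rw [Matrix.det_transpose, Matrix.det_transpose, key, Matrix.det_mul, Matrix.det_transpose,
      Matrix.det_adjugate]
    simp
  refine ⟨h1, ?_⟩
  rw [h1]
  have hp : 0 < C.det ^ 2 := by
    have := hC.ne_zero
    positivity
  generalize ((Matrix.of ![v 1 2, v 2 0, v 0 1])ᵀ).det = d
  rcases lt_trichotomy d 0 with h | h | h
  · rw [Real.sign_of_neg h, Real.sign_of_neg (mul_neg_of_pos_of_neg hp h)]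
  · simp [h]
  · rw [Real.sign_of_pos h, Real.sign_of_pos (mul_pos hp h)]
end

section
/- Let S_{αβγ} be a symmetric order-3 tensor on ℝ³ satisfying the δ-condition, and let S^1, S^2, S^3 be its matrix components, i.e. the real symmetric 3×3 matrices defined by (S^l)_{αβ} = S_{αβl}. Then the four matrices S^1, S^2, S^3, I_3 are linearly independent in the space of real symmetric 3×3 matrices. -/
open Matrix

/-- A symmetric order-3 tensor on `ℝ³`: invariant under all permutations of the
indices (generated by the two transpositions below). -/
def SymTensor (S : Fin 3 → Fin 3 → Fin 3 → ℝ) : Prop :=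
  ∀ α β γ, S α β γ = S β α γ ∧ S α β γ = S α γ β

/-- The δ-condition for a symmetric order-3 tensor on `ℝ³`. -/
def DeltaCond (S : Fin 3 → Fin 3 → Fin 3 → ℝ) : Prop :=
  ∀ α β γ η, (∑ κ, (S α β κ * S γ η κ - S γ β κ * S α η κ)) =
    (if γ = β then (1 : ℝ) else 0) * (if α = η then (1 : ℝ) else 0) -
      (if α = β then (1 : ℝ) else 0) * (if γ = η then (1 : ℝ) else 0)

/-- The matrix components of an order-3 tensor: `(Sˡ)_{αβ} = S_{αβl}`. -/
def matComp (S : Fin 3 → Fin 3 → Fin 3 → ℝ) (l : Fin 3) : Matrix (Fin 3) (Fin 3) ℝ :=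
  Matrix.of fun α β => S α β l

theorem aux_16 (S : Fin 3 → Fin 3 → Fin 3 → ℝ) (hS : SymTensor S)
    (hd : DeltaCond S) (c : Fin 3 → ℝ) (m : ℝ)
    (H : ∀ α κ, (∑ β, c β * S α β κ) = - m * (if α = κ then 1 else 0))
    (α γ : Fin 3) (hne : α ≠ γ) : c γ = 0 := by
  have key : ∑ β, c β * (∑ κ, (S α β κ * S γ α κ - S γ β κ * S α α κ))
      = ∑ κ, ((∑ β, c β * S α β κ) * S γ α κ - (∑ β, c β * S γ β κ) * S α α κ) := by
    simp only [Fin.sum_univ_three]; ring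
  have e1 : ∑ β, c β * (∑ κ, (S α β κ * S γ α κ - S γ β κ * S α α κ)) = c γ := by
    simp only [hd α _ γ α]
    simp [hne.symm]
  have e2 : S γ α α = S α α γ := by rw [(hS γ α α).1, (hS α γ α).2]
  rw [e1] at key
  rw [key]
  simp only [H]
  simp [Finset.sum_sub_distrib, e2]

/-- If a symmetric order-3 tensor satisfies the δ-condition, then
its matrix components together with the identity matrix are linearly
independent. -/
theorem stmt_16 (S : Fin 3 → Fin 3 → Fin 3 → ℝ) (hS : SymTensor S)
    (hd : DeltaCond S) :
    LinearIndependent ℝ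
      ![matComp S 0, matComp S 1, matComp S 2, (1 : Matrix (Fin 3) (Fin 3) ℝ)] := by
  rw [Fintype.linearIndependent_iff]
  intro g hg
  have H : ∀ α κ, (∑ β, (![g 0, g 1, g 2] : Fin 3 → ℝ) β * S α β κ)
      = - g 3 * (if α = κ then 1 else 0) := by
    intro α κ
    have h := congrFun (congrFun hg α) κ
    simp [Fin.sum_univ_four, matComp, Matrix.one_apply] at h
    simp only [Fin.sum_univ_three]
    rw [(hS α 0 κ).2, (hS α 1 κ).2, (hS α 2 κ).2]
    simp
    split_ifs at h ⊢ <;> linarith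
  have h0 : g 0 = 0 := aux_16 S hS hd _ _ H 1 0 (by decide)
  have h1 : g 1 = 0 := aux_16 S hS hd _ _ H 0 1 (by decide)
  have h2 : g 2 = 0 := aux_16 S hS hd _ _ H 0 2 (by decide)
  have h3 : g 3 = 0 := by
    have := H 0 0
    simp [Fin.sum_univ_three, h0, h1, h2] at this
    exact this
  intro i
  fin_cases i <;> assumption
end

section
/- Let ℒ be a 2-dimensional linear subspace of the space S(3) of real symmetric 3×3 matrices consisting of traceless matrices, and suppose ℒ has sign −1, i.e. for some (equivalently, any) basis {S_1, S_2, S_3, I_3} of the orthogonal complement ℒ^⊥ of ℒ in S(3) one has det(v_{23}, v_{31}, v_{12}) < 0, where v_{αβ} = V(S_α S_β − S_β S_α). Then there exists a symmetric order-3 tensor S_{αβγ} on ℝ³ satisfying the δ-condition such that its matrix components S^1, S^2, S^3 (defined by (S^l)_{αβ} = S_{αβl}) together with I_3 form a basis of ℒ^⊥. Conversely, if S_{αβγ} is a symmetric order-3 tensor satisfying the δ-condition, then the orthogonal complement of the linear span of {S^1, S^2, S^3, I_3} in S(3) is a 2-dimensional subspace of traceless matrices with sign −1. -/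
open Matrix

/-- `det(v₂₃, v₃₁, v₁₂)` where `v_{αβ} = V(S_α S_β − S_β S_α)`; the sign of a
2-dimensional traceless subspace `ℒ ⊆ S(3)` is the sign of this quantity for a
basis `{S₁, S₂, S₃, I}` of `ℒ^⊥`. -/
def signDet (S₁ S₂ S₃ : Matrix (Fin 3) (Fin 3) ℝ) : ℝ :=
  ((Matrix.of ![Vmap (S₂ * S₃ - S₃ * S₂), Vmap (S₃ * S₁ - S₁ * S₃),
      Vmap (S₁ * S₂ - S₂ * S₁)])ᵀ).det

lemma delta_iff (T : Fin 3 → Fin 3 → Fin 3 → ℝ) (h : SymTensor T) :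
    DeltaCond T ↔ ∀ α γ, matComp T α * matComp T γ - matComp T γ * matComp T α =
      Matrix.single γ α (1:ℝ) - Matrix.single α γ 1 := by
  have e1 : ∀ a b c, T a b c = T b c a := fun a b c => by
    rw [(h a b c).1, (h b a c).2]
  have key : ∀ α β γ η, (matComp T α * matComp T γ - matComp T γ * matComp T α) β η =
      ∑ κ, (T α β κ * T γ η κ - T γ β κ * T α η κ) := by
    intro α β γ η
    simp only [Matrix.sub_apply, Matrix.mul_apply, matComp, Matrix.of_apply,
      ← Finset.sum_sub_distrib]
    refine Finset.sum_congr rfl fun κ _ => ?_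
    rw [e1 α β κ, e1 γ η κ, e1 γ β κ, e1 α η κ, (h κ η γ).1, (h κ η α).1]
  have key2 : ∀ α β γ η : Fin 3, (Matrix.single γ α (1:ℝ) - Matrix.single α γ 1 : Matrix (Fin 3) (Fin 3) ℝ) β η =
      (if γ = β then (1 : ℝ) else 0) * (if α = η then (1 : ℝ) else 0) -
      (if α = β then (1 : ℝ) else 0) * (if γ = η then (1 : ℝ) else 0) := by
    intro α β γ η
    simp only [Matrix.sub_apply, Matrix.single_apply, ite_and, ite_mul, one_mul, zero_mul]
  constructor
  · intro hd α γ
    ext β η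
    rw [key, key2]; exact hd α β γ η
  · intro hd α β γ η
    rw [← key, ← key2, hd]

lemma matComp_symm (T : Fin 3 → Fin 3 → Fin 3 → ℝ) (h : SymTensor T) (l : Fin 3) :
    (matComp T l).IsSymm := by
  ext i j
  exact (h j i l).1

lemma linIndep_of_comm (A B C : Matrix (Fin 3) (Fin 3) ℝ)
    (h01 : A * B - B * A = Matrix.single 1 0 (1:ℝ) - Matrix.single 0 1 1)
    (h12 : B * C - C * B = Matrix.single 2 1 (1:ℝ) - Matrix.single 1 2 1)
    (h20 : C * A - A * C = Matrix.single 0 2 (1:ℝ) - Matrix.single 2 0 1) :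
    LinearIndependent ℝ ![A, B, C, (1 : Matrix (Fin 3) (Fin 3) ℝ)] := by
  rw [Fintype.linearIndependent_iff]
  intro g hg
  simp only [Fin.sum_univ_four, Matrix.cons_val] at hg
  have hA : g 1 • (A * B - B * A) - g 2 • (C * A - A * C) = 0 := by
    have : A * (g 0 • A + g 1 • B + g 2 • C + g 3 • 1) -
      (g 0 • A + g 1 • B + g 2 • C + g 3 • 1) * A = 0 := by rw [hg]; simp
    rw [← this]
    simp only [mul_add, add_mul, mul_smul_comm, smul_mul_assoc, mul_one, one_mul]
    module
  have hB : g 2 • (B * C - C * B) - g 0 • (A * B - B * A) = 0 := by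
    have : B * (g 0 • A + g 1 • B + g 2 • C + g 3 • 1) -
      (g 0 • A + g 1 • B + g 2 • C + g 3 • 1) * B = 0 := by rw [hg]; simp
    rw [← this]
    simp only [mul_add, add_mul, mul_smul_comm, smul_mul_assoc, mul_one, one_mul]
    module
  rw [h01, h20] at hA
  rw [h12, h01] at hB
  have g1 : g 1 = 0 := by simpa [Matrix.single_apply] using congrFun (congrFun hA 1) 0
  have g2 : g 2 = 0 := by simpa [Matrix.single_apply] using congrFun (congrFun hB 2) 1
  have g0 : g 0 = 0 := by simpa [Matrix.single_apply] using congrFun (congrFun hB 1) 0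
  have g3 : g 3 = 0 := by
    rw [g0, g1, g2] at hg
    simpa using congrFun (congrFun hg 0) 0
  intro i
  fin_cases i <;> assumption

/-- symmetric matrices from six parameters -/
def symOf : (Fin 6 → ℝ) →ₗ[ℝ] Matrix (Fin 3) (Fin 3) ℝ where
  toFun v := !![v 0, v 1, v 2; v 1, v 3, v 4; v 2, v 4, v 5]
  map_add' u v := by ext i j; fin_cases i <;> fin_cases j <;> rfl
  map_smul' u v := by ext i j; fin_cases i <;> fin_cases j <;> rfl

lemma symOf_apply (v : Fin 6 → ℝ) :
    symOf v = !![v 0, v 1, v 2; v 1, v 3, v 4; v 2, v 4, v 5] := rfl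

lemma symOf_inj : Function.Injective symOf := by
  intro u v h
  rw [symOf_apply, symOf_apply] at h
  have := fun i j => congrFun (congrFun h i) j
  have h0 := this 0 0
  have h1 := this 0 1
  have h2 := this 0 2
  have h3 := this 1 1
  have h4 := this 1 2
  have h5 := this 2 2
  simp at h0 h1 h2 h3 h4 h5
  ext i; fin_cases i <;> assumption

lemma symOf_symm (v : Fin 6 → ℝ) : (symOf v).IsSymm := by
  rw [symOf_apply]
  ext i j; fin_cases i <;> fin_cases j <;> rfl

lemma symOf_surj (B : Matrix (Fin 3) (Fin 3) ℝ) (h : B.IsSymm) : ∃ v, symOf v = B := by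
  refine ⟨![B 0 0, B 0 1, B 0 2, B 1 1, B 1 2, B 2 2], ?_⟩
  rw [symOf_apply]
  have h1 := h.apply 0 1
  have h2 := h.apply 0 2
  have h3 := h.apply 1 2
  ext i j; fin_cases i <;> fin_cases j <;> simp [h1, h2, h3]

lemma exists_compl (M : Fin 4 → Matrix (Fin 3) (Fin 3) ℝ) (hs : ∀ i, (M i).IsSymm)
    (hl : LinearIndependent ℝ M) : ∃ B₁ B₂ : Matrix (Fin 3) (Fin 3) ℝ,
        LinearIndependent ℝ ![B₁, B₂] ∧
        (∀ B ∈ ({B₁, B₂} : Set (Matrix (Fin 3) (Fin 3) ℝ)),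
          B.IsSymm ∧ ∀ l, (B * M l).trace = 0) ∧
        (∀ B : Matrix (Fin 3) (Fin 3) ℝ, B.IsSymm →
          (∀ l, (B * M l).trace = 0) →
          B ∈ Submodule.span ℝ ({B₁, B₂} : Set (Matrix (Fin 3) (Fin 3) ℝ))) := by
  let φ : Fin 4 → Module.Dual ℝ (Fin 6 → ℝ) := fun l =>
    (Matrix.traceLinearMap (Fin 3) ℝ ℝ) ∘ₗ (LinearMap.mulRight ℝ (M l)) ∘ₗ symOf
  have hφ : ∀ l v, φ l v = (symOf v * M l).trace := fun l v => rfl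
  have hli : LinearIndependent ℝ φ := by
    rw [Fintype.linearIndependent_iff] at hl ⊢
    intro g hg
    apply hl g
    obtain ⟨w, hw⟩ := symOf_surj (∑ i, g i • M i) (by
      unfold Matrix.IsSymm
      rw [Matrix.transpose_sum]
      refine Finset.sum_congr rfl fun i _ => ?_
      rw [Matrix.transpose_smul, (hs i)])
    have h2 : (symOf w * ∑ i, g i • M i).trace = 0 := by
      have := congrArg (fun f => f w) hg
      simp only [LinearMap.sum_apply, LinearMap.smul_apply, hφ, LinearMap.zero_apply] at this
      rw [← this, Finset.mul_sum, Matrix.trace_sum]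
      refine Finset.sum_congr rfl fun i _ => ?_
      rw [Matrix.mul_smul, Matrix.trace_smul]
    rw [hw] at h2
    rw [← hw] at h2 ⊢
    have h3 := symOf_symm w
    have h4 : (symOf w)ᴴ * symOf w = symOf w * symOf w := by
      rw [Matrix.conjTranspose_eq_transpose_of_trivial, h3]
    rw [← h4, Matrix.trace_conjTranspose_mul_self_eq_zero_iff] at h2
    exact h2
  let U := Submodule.span ℝ (Set.range φ)
  have hU : Module.finrank ℝ U = 4 := by
    simpa using finrank_span_eq_card hli
  have hK : Module.finrank ℝ U.dualCoannihilator = 2 := by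
    have := Subspace.finrank_add_finrank_dualCoannihilator_eq U
    rw [hU, Module.finrank_fin_fun] at this
    omega
  have hmem : ∀ v, v ∈ U.dualCoannihilator ↔ ∀ l, (symOf v * M l).trace = 0 := by
    intro v
    rw [Submodule.mem_dualCoannihilator]
    constructor
    · intro h l
      exact h (φ l) (Submodule.subset_span ⟨l, rfl⟩)
    · intro h f hf
      induction hf using Submodule.span_induction with
      | mem x hx => obtain ⟨l, rfl⟩ := hx; exact h l
      | zero => rfl
      | add x y _ _ hx hy => simp [hx, hy]
      | smul a x _ hx => simp [hx]
  let b := Module.finBasisOfFinrankEq ℝ U.dualCoannihilator hK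
  refine ⟨symOf (b 0), symOf (b 1), ?_, ?_, ?_⟩
  · have h1 := b.linearIndependent
    rw [LinearIndependent.pair_iff]
    intro s t hst
    rw [Fintype.linearIndependent_iff] at h1
    have h2 : s • (b 0) + t • (b 1) = 0 := by
      apply Subtype.ext
      apply symOf_inj
      simpa using hst
    have := h1 ![s, t] (by simpa [Fin.sum_univ_two] using h2)
    exact ⟨this 0, this 1⟩
  · intro B hB
    rcases hB with rfl | rfl
    · exact ⟨symOf_symm _, (hmem _).1 (b 0).2⟩
    · exact ⟨symOf_symm _, (hmem _).1 (b 1).2⟩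
  · intro B hB h
    obtain ⟨v, rfl⟩ := symOf_surj B hB
    have hv := (hmem v).2 h
    have := b.sum_repr ⟨v, hv⟩
    rw [Fin.sum_univ_two] at this
    have h3 := congrArg (fun x => symOf (Subtype.val x)) this
    simp only [Submodule.coe_add, Submodule.coe_smul, map_add, map_smul] at h3
    rw [Submodule.mem_span_pair]
    exact ⟨_, _, h3⟩

lemma converse_part (T : Fin 3 → Fin 3 → Fin 3 → ℝ) (hT : SymTensor T) (hD : DeltaCond T) :
      LinearIndependent ℝ
        ![matComp T 0, matComp T 1, matComp T 2, (1 : Matrix (Fin 3) (Fin 3) ℝ)] ∧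
      signDet (matComp T 0) (matComp T 1) (matComp T 2) < 0 ∧
      ∃ B₁ B₂ : Matrix (Fin 3) (Fin 3) ℝ,
        LinearIndependent ℝ ![B₁, B₂] ∧
        (∀ B ∈ ({B₁, B₂} : Set (Matrix (Fin 3) (Fin 3) ℝ)),
          B.IsSymm ∧ B.trace = 0 ∧ ∀ l : Fin 3, (B * matComp T l).trace = 0) ∧
        (∀ B : Matrix (Fin 3) (Fin 3) ℝ, B.IsSymm → B.trace = 0 →
          (∀ l : Fin 3, (B * matComp T l).trace = 0) →
          B ∈ Submodule.span ℝ ({B₁, B₂} : Set (Matrix (Fin 3) (Fin 3) ℝ))) := by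
  have hc := (delta_iff T hT).1 hD
  have hl := linIndep_of_comm _ _ _ (hc 0 1) (hc 1 2) (hc 2 0)
  refine ⟨hl, ?_, ?_⟩
  · unfold signDet
    rw [hc 0 1, hc 1 2, hc 2 0]
    simp [Vmap, Matrix.det_fin_three, Matrix.single_apply]
  · obtain ⟨B₁, B₂, h1, h2, h3⟩ := exists_compl _ (by
      intro i
      fin_cases i
      · exact matComp_symm T hT 0
      · exact matComp_symm T hT 1
      · exact matComp_symm T hT 2
      · exact Matrix.isSymm_one) hl
    refine ⟨B₁, B₂, h1, ?_, ?_⟩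
    · intro B hB
      obtain ⟨hs, ht⟩ := h2 B hB
      refine ⟨hs, by simpa using ht 3, ?_⟩
      intro l
      fin_cases l
      · exact ht 0
      · exact ht 1
      · exact ht 2
    · intro B hs ht hl
      apply h3 B hs
      intro l
      fin_cases l
      · exact hl 0
      · exact hl 1
      · exact hl 2
      · simpa using ht

/-- Normalization of the commutators. -/
lemma exists_norm (S₁ S₂ S₃ : Matrix (Fin 3) (Fin 3) ℝ)
    (s1 : S₁.IsSymm) (s2 : S₂.IsSymm) (s3 : S₃.IsSymm) (hs : signDet S₁ S₂ S₃ < 0) :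
    ∃ a : Fin 3 → Fin 3 → ℝ, ∃ R : Fin 3 → Matrix (Fin 3) (Fin 3) ℝ,
      (∀ l, R l = a l 0 • S₁ + a l 1 • S₂ + a l 2 • S₃) ∧
      R 0 * R 1 - R 1 * R 0 = Matrix.single 1 0 (1:ℝ) - Matrix.single 0 1 1 ∧
      R 1 * R 2 - R 2 * R 1 = Matrix.single 2 1 (1:ℝ) - Matrix.single 1 2 1 ∧
      R 2 * R 0 - R 0 * R 2 = Matrix.single 0 2 (1:ℝ) - Matrix.single 2 0 1 := by
  have skew : ∀ A B : Matrix (Fin 3) (Fin 3) ℝ, A.IsSymm → B.IsSymm → ∃ p : Fin 3 → ℝ,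
      p = Vmap (A * B - B * A) ∧
      A * B - B * A = !![0, p 2, - p 1; - p 2, 0, p 0; p 1, - p 0, 0] := by
    intro A B hA hB
    refine ⟨_, rfl, ?_⟩
    have hk : (A * B - B * A)ᵀ = - (A * B - B * A) := by
      rw [Matrix.transpose_sub, Matrix.transpose_mul, Matrix.transpose_mul, hA, hB]; abel
    generalize A * B - B * A = C at hk
    have hk' : ∀ i j, C j i = - C i j := fun i j => congrFun (congrFun hk i) j
    have h00 := hk' 0 0
    have h11 := hk' 1 1
    have h22 := hk' 2 2
    have h01 := hk' 0 1
    have h02 := hk' 0 2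
    have h12 := hk' 1 2
    ext i j; fin_cases i <;> fin_cases j <;> simp [Vmap] <;> linarith
  obtain ⟨p, hp, hp'⟩ := skew S₂ S₃ s2 s3
  obtain ⟨q, hq, hq'⟩ := skew S₃ S₁ s3 s1
  obtain ⟨r, hr, hr'⟩ := skew S₁ S₂ s1 s2
  unfold signDet at hs
  rw [← hp, ← hq, ← hr] at hs
  simp [Matrix.det_fin_three] at hs
  obtain ⟨d, hd⟩ : ∃ d : ℝ, d ^ 2 * (p 0 * q 1 * r 2 - p 0 * r 1 * q 2 - q 0 * p 1 * r 2
      + q 0 * r 1 * p 2 + r 0 * p 1 * q 2 - r 0 * q 1 * p 2) = -1 := by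
    generalize hD : (p 0 * q 1 * r 2 - p 0 * r 1 * q 2 - q 0 * p 1 * r 2
      + q 0 * r 1 * p 2 + r 0 * p 1 * q 2 - r 0 * q 1 * p 2) = D
    have hD0 : D < 0 := by rw [← hD]; linarith
    refine ⟨√(-D⁻¹), ?_⟩
    rw [Real.sq_sqrt (by simpa using hD0.le)]
    have := hD0.ne
    field_simp
  have comm : ∀ x y : Fin 3 → ℝ,
      (x 0 • S₁ + x 1 • S₂ + x 2 • S₃) * (y 0 • S₁ + y 1 • S₂ + y 2 • S₃) -
      (y 0 • S₁ + y 1 • S₂ + y 2 • S₃) * (x 0 • S₁ + x 1 • S₂ + x 2 • S₃) =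
      (x 1 * y 2 - x 2 * y 1) • (S₂ * S₃ - S₃ * S₂) +
      (x 2 * y 0 - x 0 * y 2) • (S₃ * S₁ - S₁ * S₃) +
      (x 0 * y 1 - x 1 * y 0) • (S₁ * S₂ - S₂ * S₁) := by
    intro x y
    simp only [mul_add, add_mul, mul_smul_comm, smul_mul_assoc]
    module
  rw [hp', hq', hr'] at comm
  clear hp hq hr hp' hq' hr' hs
  refine ⟨fun l => ![d * p l, d * q l, d * r l], fun l => (d * p l) • S₁ + (d * q l) • S₂ +
    (d * r l) • S₃, fun l => by simp, ?_, ?_, ?_⟩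
  · refine (comm ![d * p 0, d * q 0, d * r 0] ![d * p 1, d * q 1, d * r 1]).trans ?_
    ext i j
    fin_cases i <;> fin_cases j <;> simp [Matrix.single_apply] <;> first | ring1 | linear_combination hd | linear_combination -hd
  · refine (comm ![d * p 1, d * q 1, d * r 1] ![d * p 2, d * q 2, d * r 2]).trans ?_
    ext i j
    fin_cases i <;> fin_cases j <;> simp [Matrix.single_apply] <;> first | ring1 | linear_combination hd | linear_combination -hd
  · refine (comm ![d * p 2, d * q 2, d * r 2] ![d * p 0, d * q 0, d * r 0]).trans ?_
    ext i j
    fin_cases i <;> fin_cases j <;> simp [Matrix.single_apply] <;> first | ring1 | linear_combination hd | linear_combination -hd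

lemma exists_tensor (R : Fin 3 → Matrix (Fin 3) (Fin 3) ℝ) (hR : ∀ l, (R l).IsSymm)
      (h01 : R 0 * R 1 - R 1 * R 0 = Matrix.single 1 0 (1:ℝ) - Matrix.single 0 1 1)
      (h12 : R 1 * R 2 - R 2 * R 1 = Matrix.single 2 1 (1:ℝ) - Matrix.single 1 2 1)
      (h20 : R 2 * R 0 - R 0 * R 2 = Matrix.single 0 2 (1:ℝ) - Matrix.single 2 0 1) :
    ∃ T, SymTensor T ∧ DeltaCond T ∧ ∃ b : Fin 3 → ℝ, ∀ l, matComp T l = R l + b l • 1 := by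
  have jac : (R 0 * (R 1 * R 2 - R 2 * R 1) - (R 1 * R 2 - R 2 * R 1) * R 0) +
    (R 1 * (R 2 * R 0 - R 0 * R 2) - (R 2 * R 0 - R 0 * R 2) * R 1) +
    (R 2 * (R 0 * R 1 - R 1 * R 0) - (R 0 * R 1 - R 1 * R 0) * R 2) = 0 := by noncomm_ring
  rw [h01, h12, h20] at jac
  have J := fun i j => congrFun (congrFun jac i) j
  have j00 := J 0 0
  have j01 := J 0 1
  have j02 := J 0 2
  have j11 := J 1 1
  have j12 := J 1 2
  have j22 := J 2 2
  simp [Matrix.mul_apply, Fin.sum_univ_three, Matrix.single_apply] at j00 j01 j02 j11 j12 j22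
  have y01 := fun l => (hR l).apply 0 1
  have y02 := fun l => (hR l).apply 0 2
  have y12 := fun l => (hR l).apply 1 2
  simp only [y01, y02, y12] at j00 j01 j02 j11 j12 j22
  let b : Fin 3 → ℝ := ![R 1 0 1 - R 0 1 1, R 0 0 1 - R 1 0 0, R 0 0 2 - R 2 0 0]
  let T : Fin 3 → Fin 3 → Fin 3 → ℝ := fun α β l => (R l + b l • (1 : Matrix (Fin 3) (Fin 3) ℝ)) α β
  have hm : ∀ l, matComp T l = R l + b l • 1 := fun l => by ext; rfl
  have hS : SymTensor T := by
    intro α β γ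
    constructor
    · have : (R γ + b γ • (1 : Matrix (Fin 3) (Fin 3) ℝ)).IsSymm :=
        (hR γ).add (Matrix.isSymm_one.smul _)
      exact this.apply β α
    · fin_cases α <;> fin_cases β <;> fin_cases γ <;> simp [T, b, y01, y02, y12] <;> linarith
  refine ⟨T, hS, ?_, b, hm⟩
  rw [delta_iff T hS]
  have hcm : ∀ α γ, matComp T α * matComp T γ - matComp T γ * matComp T α =
      R α * R γ - R γ * R α := by
    intro α γ
    rw [hm, hm]
    simp only [mul_add, add_mul, mul_smul_comm, smul_mul_assoc, mul_one, one_mul]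
    module
  intro α γ
  rw [hcm]
  have sw : ∀ i j, R i * R j - R j * R i = Matrix.single j i (1:ℝ) - Matrix.single i j 1 →
    R j * R i - R i * R j = Matrix.single i j (1:ℝ) - Matrix.single j i 1 := by
    intro i j h
    rw [← neg_sub, h, neg_sub]
  fin_cases α <;> fin_cases γ
  · simp
  · exact h01
  · exact sw _ _ h20
  · exact sw _ _ h01
  · simp
  · exact h12
  · exact h20
  · exact sw _ _ h12
  · simp

/-- (⇒) A 2-dimensional traceless subspace `ℒ ⊆ S(3)` of sign `−1`
(encoded by a basis `{S₁, S₂, S₃, I}` of its orthogonal complement `ℒ^⊥` with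
`det(v₂₃, v₃₁, v₁₂) < 0`) arises from a symmetric tensor satisfying the
δ-condition: the matrix components of the tensor, together with `I₃`, form a
basis of `ℒ^⊥` (i.e. they are linearly independent and span the same subspace).
(⇐) Conversely, for any symmetric tensor satisfying the δ-condition, the
matrix components together with `I₃` are linearly independent, have
`det(v₂₃, v₃₁, v₁₂) < 0`, and their orthogonal complement in `S(3)` (w.r.t. the
trace inner product) is a 2-dimensional subspace of traceless symmetric
matrices. -/
theorem stmt_17 :
    (∀ S₁ S₂ S₃ : Matrix (Fin 3) (Fin 3) ℝ,
      S₁.IsSymm → S₂.IsSymm → S₃.IsSymm →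
      LinearIndependent ℝ ![S₁, S₂, S₃, (1 : Matrix (Fin 3) (Fin 3) ℝ)] →
      signDet S₁ S₂ S₃ < 0 →
      ∃ T : Fin 3 → Fin 3 → Fin 3 → ℝ, SymTensor T ∧ DeltaCond T ∧
        LinearIndependent ℝ
          ![matComp T 0, matComp T 1, matComp T 2, (1 : Matrix (Fin 3) (Fin 3) ℝ)] ∧
        Submodule.span ℝ
            ({matComp T 0, matComp T 1, matComp T 2, (1 : Matrix (Fin 3) (Fin 3) ℝ)} :
              Set (Matrix (Fin 3) (Fin 3) ℝ)) =
          Submodule.span ℝ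
            ({S₁, S₂, S₃, (1 : Matrix (Fin 3) (Fin 3) ℝ)} :
              Set (Matrix (Fin 3) (Fin 3) ℝ))) ∧
    (∀ T : Fin 3 → Fin 3 → Fin 3 → ℝ, SymTensor T → DeltaCond T →
      LinearIndependent ℝ
        ![matComp T 0, matComp T 1, matComp T 2, (1 : Matrix (Fin 3) (Fin 3) ℝ)] ∧
      signDet (matComp T 0) (matComp T 1) (matComp T 2) < 0 ∧
      ∃ B₁ B₂ : Matrix (Fin 3) (Fin 3) ℝ,
        LinearIndependent ℝ ![B₁, B₂] ∧
        (∀ B ∈ ({B₁, B₂} : Set (Matrix (Fin 3) (Fin 3) ℝ)),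
          B.IsSymm ∧ B.trace = 0 ∧ ∀ l : Fin 3, (B * matComp T l).trace = 0) ∧
        (∀ B : Matrix (Fin 3) (Fin 3) ℝ, B.IsSymm → B.trace = 0 →
          (∀ l : Fin 3, (B * matComp T l).trace = 0) →
          B ∈ Submodule.span ℝ ({B₁, B₂} : Set (Matrix (Fin 3) (Fin 3) ℝ)))) := by
  refine ⟨?_, converse_part⟩
  intro S₁ S₂ S₃ s1 s2 s3 _ hs
  obtain ⟨a, R, hR, h01, h12, h20⟩ := exists_norm S₁ S₂ S₃ s1 s2 s3 hs
  obtain ⟨T, hS, hD, b, hb⟩ := exists_tensor R (fun l => by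
    rw [hR]
    exact ((s1.smul _).add (s2.smul _)).add (s3.smul _)) h01 h12 h20
  have hl := (converse_part T hS hD).1
  refine ⟨T, hS, hD, hl, ?_⟩
  have hr : ∀ A B C D : Matrix (Fin 3) (Fin 3) ℝ,
      ({A, B, C, D} : Set (Matrix (Fin 3) (Fin 3) ℝ)) = Set.range ![A, B, C, D] := by
    intro A B C D
    simp only [Matrix.range_cons, Matrix.range_empty, Set.insert_eq, Set.union_empty]
  apply Submodule.eq_of_le_of_finrank_le
  · have m1 : S₁ ∈ Submodule.span ℝ ({S₁, S₂, S₃, 1} : Set (Matrix (Fin 3) (Fin 3) ℝ)) :=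
      Submodule.subset_span (by simp)
    have m2 : S₂ ∈ Submodule.span ℝ ({S₁, S₂, S₃, 1} : Set (Matrix (Fin 3) (Fin 3) ℝ)) :=
      Submodule.subset_span (by simp)
    have m3 : S₃ ∈ Submodule.span ℝ ({S₁, S₂, S₃, 1} : Set (Matrix (Fin 3) (Fin 3) ℝ)) :=
      Submodule.subset_span (by simp)
    have m4 : 1 ∈ Submodule.span ℝ ({S₁, S₂, S₃, 1} : Set (Matrix (Fin 3) (Fin 3) ℝ)) :=
      Submodule.subset_span (by simp)
    have hm : ∀ l, matComp T l ∈
        Submodule.span ℝ ({S₁, S₂, S₃, 1} : Set (Matrix (Fin 3) (Fin 3) ℝ)) := by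
      intro l
      rw [hb, hR]
      exact add_mem (add_mem (add_mem (Submodule.smul_mem _ _ m1) (Submodule.smul_mem _ _ m2))
        (Submodule.smul_mem _ _ m3)) (Submodule.smul_mem _ _ m4)
    rw [Submodule.span_le]
    rintro x (rfl | rfl | rfl | rfl)
    · exact hm 0
    · exact hm 1
    · exact hm 2
    · exact m4
  · rw [hr, hr, finrank_span_eq_card hl]
    exact finrank_range_le_card _
end

section
/- Let v, w ∈ ℍ³ be quaternionic column vectors of length 3 such that Re(v_α · conj(v_β)) = Re(w_α · conj(w_β)) for all α, β ∈ {1,2,3} (i.e. the real parts of the matrices vv* and ww* coincide entrywise). Then there exist quaternions h, h' of norm 1 such that h' · v_α = w_α · h for all α ∈ {1,2,3}. -/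
namespace S18

open Quaternion

/-- Real inner product. -/
noncomputable def ip (x y : Quaternion ℝ) : ℝ := (x * star y).re

lemma unit_mul_star {u : Quaternion ℝ} (hu : ‖u‖ = 1) : u * star u = 1 := by
  rw [Quaternion.self_mul_star, Quaternion.normSq_eq_norm_mul_self, hu]; simp

lemma unit_star_mul {u : Quaternion ℝ} (hu : ‖u‖ = 1) : star u * u = 1 := by
  rw [Quaternion.star_mul_self, Quaternion.normSq_eq_norm_mul_self, hu]; simp

lemma refl_formula (d x : Quaternion ℝ) :
    d * star x * d = (2 * ip x d) • d - (ip d d) • x := by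
  ext <;> simp [ip] <;> ring

lemma ip_refl (u x y : Quaternion ℝ) :
    ip (-(u * star x * u)) (-(u * star y * u)) = (ip u u) ^ 2 * ip x y := by
  simp [ip]; ring

lemma ip_unit {u : Quaternion ℝ} (hu : ‖u‖ = 1) : ip u u = 1 := by
  simp [ip, unit_mul_star hu]

lemma ip_self_ne {d : Quaternion ℝ} (hd : d ≠ 0) : ip d d ≠ 0 := by
  have : ip d d = Quaternion.normSq d := by simp [ip, Quaternion.self_mul_star]
  rw [this]; exact Quaternion.normSq_ne_zero.2 hd

lemma exists_unit {d : Quaternion ℝ} (hd : d ≠ 0) :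
    ∃ u : Quaternion ℝ, ‖u‖ = 1 ∧ ∀ x, -(u * star x * u) = x - (2 * ip x d / ip d d) • d := by
  have hn : ‖d‖ ≠ 0 := norm_ne_zero_iff.2 hd
  have hdd : ip d d = ‖d‖ * ‖d‖ := by
    rw [← Quaternion.normSq_eq_norm_mul_self]; simp [ip, Quaternion.self_mul_star]
  refine ⟨‖d‖⁻¹ • d, by simp [norm_smul, hn], fun x => ?_⟩
  rw [smul_mul_assoc, smul_mul_assoc, mul_smul_comm, refl_formula, smul_smul, smul_sub,
    smul_smul, smul_smul, hdd]
  have h1 : ‖d‖⁻¹ * ‖d‖⁻¹ * (‖d‖ * ‖d‖) = 1 := by field_simp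
  have h2 : ‖d‖⁻¹ * ‖d‖⁻¹ * (2 * ip x d) = 2 * ip x d / (‖d‖ * ‖d‖) := by field_simp
  rw [h1, h2, one_smul, neg_sub]

def E (v w : Fin 3 → Quaternion ℝ) : Prop :=
  ∃ a b : Quaternion ℝ, ‖a‖ = 1 ∧ ‖b‖ = 1 ∧ ∀ i, w i = a * v i * b

def O (v w : Fin 3 → Quaternion ℝ) : Prop :=
  ∃ a b : Quaternion ℝ, ‖a‖ = 1 ∧ ‖b‖ = 1 ∧ ∀ i, w i = a * star (v i) * b

lemma E_refl {v w : Fin 3 → Quaternion ℝ} (h : E v w) {u : Quaternion ℝ} (hu : ‖u‖ = 1) :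
    O v (fun i => -(u * star (w i) * u)) := by
  obtain ⟨a, b, ha, hb, h⟩ := h
  refine ⟨-(u * star b), star a * u, by simp [hu, hb], by simp [hu, ha], fun i => ?_⟩
  simp [h, mul_assoc]

lemma O_refl {v w : Fin 3 → Quaternion ℝ} (h : O v w) {u : Quaternion ℝ} (hu : ‖u‖ = 1) :
    E v (fun i => -(u * star (w i) * u)) := by
  obtain ⟨a, b, ha, hb, h⟩ := h
  refine ⟨-(u * star b), star a * u, by simp [hu, hb], by simp [hu, ha], fun i => ?_⟩
  simp [h, mul_assoc]

lemma step {v x w : Fin 3 → Quaternion ℝ} (h : E v x ∨ O v x)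
    (hg : ∀ i j, ip (x i) (x j) = ip (w i) (w j)) (k : Fin 3) :
    ∃ y : Fin 3 → Quaternion ℝ, (E v y ∨ O v y) ∧
      (∀ i j, ip (y i) (y j) = ip (w i) (w j)) ∧ y k = w k ∧ ∀ i, x i = w i → y i = w i := by
  by_cases hk : x k = w k
  · exact ⟨x, h, hg, hk, fun i hi => hi⟩
  have hd : x k - w k ≠ 0 := sub_ne_zero.2 hk
  obtain ⟨u, hu, hf⟩ := exists_unit hd
  refine ⟨fun i => -(u * star (x i) * u), ?_, ?_, ?_, ?_⟩
  · rcases h with h | h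
    · exact Or.inr (E_refl h hu)
    · exact Or.inl (O_refl h hu)
  · intro i j
    simp only [ip_refl, ip_unit hu, hg]; ring
  · show -(u * star (x k) * u) = w k
    rw [hf]
    have h1 : 2 * ip (x k) (x k - w k) = ip (x k - w k) (x k - w k) := by
      have := hg k k
      simp [ip] at this ⊢
      linarith
    rw [h1, div_self (ip_self_ne hd), one_smul]; abel
  · intro i hi
    show -(u * star (x i) * u) = w i
    rw [hf]
    have h1 : ip (x i) (x k - w k) = 0 := by
      have := hg i k
      rw [hi] at this ⊢
      simp [ip] at this ⊢
      linarith
    rw [h1, hi]; simp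

lemma exists_orth (w : Fin 3 → Quaternion ℝ) : ∃ d : Quaternion ℝ, d ≠ 0 ∧ ∀ i, ip (w i) d = 0 := by
  let f : Quaternion ℝ →ₗ[ℝ] (Fin 3 → ℝ) := LinearMap.pi fun i => (innerₛₗ ℝ (w i))
  have hf : LinearMap.ker f ≠ ⊥ := by
    apply LinearMap.ker_ne_bot_of_finrank_lt
    rw [Quaternion.finrank_eq_four]; simp
  obtain ⟨d, hd, h0⟩ := (Submodule.ne_bot_iff _).1 hf
  refine ⟨d, h0, fun i => ?_⟩
  have := congrFun (LinearMap.mem_ker.1 hd) i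
  simpa [f, ip, Quaternion.inner_def] using this

end S18

/-- If `v, w ∈ ℍ³` satisfy `Re(v_α conj(v_β)) = Re(w_α conj(w_β))`
for all `α, β` (i.e. `Re(vv*) = Re(ww*)` entrywise), then there exist unit-norm
quaternions `h, h'` with `h' ⬝ v_α = w_α ⬝ h` for all `α`. -/
theorem stmt_18 (v w : Fin 3 → Quaternion ℝ)
    (hvw : ∀ α β : Fin 3, (v α * star (v β)).re = (w α * star (w β)).re) :
    ∃ h h' : Quaternion ℝ, ‖h‖ = 1 ∧ ‖h'‖ = 1 ∧ ∀ α : Fin 3, h' * v α = w α * h := by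
  have hE : S18.E v v := ⟨1, 1, by simp, by simp, fun i => by simp⟩
  obtain ⟨x, hx, gx, x0, -⟩ := S18.step (w := w) (Or.inl hE) hvw 0
  obtain ⟨y, hy, gy, y1, hxy⟩ := S18.step hx gx 1
  obtain ⟨z, hz, gz, z2, hyz⟩ := S18.step hy gy 2
  have hzw : z = w := by
    funext i
    fin_cases i
    · exact hyz _ (hxy _ x0)
    · exact hyz _ y1
    · exact z2
  subst hzw
  have key : S18.E v z := by
    rcases hz with h | h
    · exact h
    obtain ⟨d, hd, h0⟩ := S18.exists_orth z
    obtain ⟨u, hu, hf⟩ := S18.exists_unit hd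
    have h2 := S18.O_refl h hu
    have : (fun i => -(u * star (z i) * u)) = z := by
      funext i
      rw [hf, h0]; simp
    rwa [this] at h2
  obtain ⟨a, b, ha, hb, h⟩ := key
  refine ⟨star b, a, by simpa using hb, ha, fun i => ?_⟩
  rw [h, mul_assoc, S18.unit_mul_star hb, mul_one]
end

section
/- Let A be a quaternionic hermitian n×n matrix (A = A*, where * is the quaternionic conjugate transpose), written as A = A_r + i·A_i + j·A_j + k·A_k with real n×n matrices A_r, A_i, A_j, A_k, and let 𝓘_q(A) be the real 4n×4n matrix given in 4×4 block form by [[A_r, −A_i, −A_j, −A_k], [A_i, A_r, −A_k, A_j], [A_j, A_k, A_r, −A_i], [A_k, −A_j, A_i, A_r]]. Then the characteristic polynomial of 𝓘_q(A) is the fourth power of a monic real polynomial of degree n; i.e. there exists a monic polynomial p ∈ ℝ[λ] of degree n with charpoly(𝓘_q(A)) = p⁴. -/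
open Matrix

/-- The `4 × 4` real matrix of components of a quaternion, as it appears in the
standard real representation `𝓘_q` of quaternionic matrices: the `(a, b)` block
of `𝓘_q(A)` has `(i, j)` entry `IqEntry (A i j) a b`. -/
def IqEntry (q : Quaternion ℝ) : Fin 4 → Fin 4 → ℝ :=
  ![![q.re, -q.imI, -q.imJ, -q.imK],
    ![q.imI, q.re, -q.imK, q.imJ],
    ![q.imJ, q.imK, q.re, -q.imI],
    ![q.imK, -q.imJ, q.imI, q.re]]

/-- The standard representation of a quaternionic `n × n` matrix
`A = A_r + i A_i + j A_j + k A_k` as the real `4n × 4n` matrix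
`[[A_r, −A_i, −A_j, −A_k], [A_i, A_r, −A_k, A_j], [A_j, A_k, A_r, −A_i],
[A_k, −A_j, A_i, A_r]]`. -/
def Iq {n : ℕ} (A : Matrix (Fin n) (Fin n) (Quaternion ℝ)) :
    Matrix (Fin 4 × Fin n) (Fin 4 × Fin n) ℝ :=
  Matrix.of fun p q => IqEntry (A p.2 q.2) p.1 q.1

open Polynomial in
lemma exists_fourth_root (f : ℝ[X]) (hf : f.Monic) (hs : f.Splits)
    (h4 : ∀ μ, 4 ∣ f.rootMultiplicity μ) :
    ∃ p : ℝ[X], p.Monic ∧ f = p ^ 4 := by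
  obtain ⟨s, hs'⟩ := Multiset.exists_smul_of_dvd_count f.roots (k := 4) (fun a _ => by
    rw [count_roots]; exact h4 a)
  refine ⟨(s.map (fun a => X - C a)).prod, monic_multiset_prod_of_monic _ _ fun a _ => monic_X_sub_C a, ?_⟩
  conv_lhs => rw [hs.eq_prod_roots_of_monic hf, hs']
  rw [Multiset.map_nsmul, Multiset.prod_nsmul]

/-- real coordinates -/
def qCoord (n : ℕ) : (Fin n → Quaternion ℝ) ≃ₗ[ℝ] (Fin 4 × Fin n → ℝ) where
  toFun v p := ![(v p.2).re, (v p.2).imI, (v p.2).imJ, (v p.2).imK] p.1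
  invFun w j := ⟨w (0, j), w (1, j), w (2, j), w (3, j)⟩
  map_add' v w := by ext ⟨a, j⟩; fin_cases a <;> simp
  map_smul' c w := by ext ⟨a, j⟩; fin_cases a <;> simp
  left_inv v := by ext j <;> simp
  right_inv w := by ext ⟨a, j⟩; fin_cases a <;> simp

/-- left multiplication -/
noncomputable def qMul {n : ℕ} (A : Matrix (Fin n) (Fin n) (Quaternion ℝ)) :
    Module.End ℝ (Fin n → Quaternion ℝ) where
  toFun v := A *ᵥ v
  map_add' v w := Matrix.mulVec_add _ _ _
  map_smul' c v := Matrix.mulVec_smul _ _ _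

/-- right multiplication -/
noncomputable def qRight (n : ℕ) (c : (Quaternion ℝ)ᵐᵒᵖ) :
    Module.End ℝ (Fin n → Quaternion ℝ) where
  toFun v := c • v
  map_add' v w := smul_add _ _ _
  map_smul' r v := smul_comm _ _ _

lemma qRight_comm {n : ℕ} (A : Matrix (Fin n) (Fin n) (Quaternion ℝ)) (c : (Quaternion ℝ)ᵐᵒᵖ) :
    Commute (qMul A) (qRight n c) := by
  refine LinearMap.ext fun v => ?_
  exact Matrix.mulVec_smul A c v

lemma Iq_eq {n : ℕ} (A : Matrix (Fin n) (Fin n) (Quaternion ℝ)) :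
    Matrix.toLin' (Iq A) = (qCoord n).conj (qMul A) := by
  refine LinearMap.ext fun w => ?_
  obtain ⟨v, rfl⟩ := (qCoord n).surjective w
  rw [LinearEquiv.conj_apply_apply, LinearEquiv.symm_apply_apply]
  have hre : ∀ f : Fin n → Quaternion ℝ, (∑ i, f i).re = ∑ i, (f i).re := fun f =>
    map_sum (⟨⟨fun q => q.re, rfl⟩, fun _ _ => rfl⟩ : Quaternion ℝ →+ ℝ) _ _
  have hi : ∀ f : Fin n → Quaternion ℝ, (∑ i, f i).imI = ∑ i, (f i).imI := fun f =>
    map_sum (⟨⟨fun q => q.imI, rfl⟩, fun _ _ => rfl⟩ : Quaternion ℝ →+ ℝ) _ _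
  have hj : ∀ f : Fin n → Quaternion ℝ, (∑ i, f i).imJ = ∑ i, (f i).imJ := fun f =>
    map_sum (⟨⟨fun q => q.imJ, rfl⟩, fun _ _ => rfl⟩ : Quaternion ℝ →+ ℝ) _ _
  have hk : ∀ f : Fin n → Quaternion ℝ, (∑ i, f i).imK = ∑ i, (f i).imK := fun f =>
    map_sum (⟨⟨fun q => q.imK, rfl⟩, fun _ _ => rfl⟩ : Quaternion ℝ →+ ℝ) _ _
  ext ⟨a, i⟩
  rw [Matrix.toLin'_apply]
  have hc : ∀ (v : Fin n → Quaternion ℝ) p,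
    qCoord n v p = ![(v p.2).re, (v p.2).imI, (v p.2).imJ, (v p.2).imK] p.1 := fun _ _ => rfl
  have hm : ∀ i, qMul A v i = ∑ j, A i j * v j := fun _ => rfl
  simp only [Matrix.mulVec, dotProduct, Fintype.sum_prod_type_right, Iq, Matrix.of_apply, hc, hm,
    hre, hi, hj, hk]
  fin_cases a <;>
  · simp [IqEntry, Fin.sum_univ_four, -Finset.sum_sub_distrib, -Finset.sum_add_distrib]
    try
      refine Finset.sum_congr rfl fun j _ => ?_
      ring

lemma Iq_herm {n : ℕ} (A : Matrix (Fin n) (Fin n) (Quaternion ℝ)) (hA : A.IsHermitian) :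
    (Iq A).IsHermitian := by
  ext ⟨a, i⟩ ⟨b, j⟩
  have h := hA.apply i j
  simp only [Matrix.conjTranspose_apply, Iq, Matrix.of_apply, ← h]
  fin_cases a <;> fin_cases b <;> simp [IqEntry]

/-- generalized eigenspace as a right quaternionic submodule -/
noncomputable def qEig {n : ℕ} (A : Matrix (Fin n) (Fin n) (Quaternion ℝ)) (μ : ℝ) :
    Submodule (Quaternion ℝ)ᵐᵒᵖ (Fin n → Quaternion ℝ) where
  carrier := (qMul A).maxGenEigenspace μ
  add_mem' := fun h h' => Submodule.add_mem _ h h'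
  zero_mem' := Submodule.zero_mem _
  smul_mem' c _ hx := Module.End.mapsTo_maxGenEigenspace_of_comm (qRight_comm A c) μ hx

lemma dvd_mult {n : ℕ} (A : Matrix (Fin n) (Fin n) (Quaternion ℝ)) (μ : ℝ) :
    4 ∣ (qMul A).charpoly.rootMultiplicity μ := by
  rw [← LinearMap.finrank_maxGenEigenspace_eq]
  have e : (qEig A μ).restrictScalars ℝ = (qMul A).maxGenEigenspace μ := rfl
  rw [← e]
  have h4 : Module.finrank ℝ (Quaternion ℝ)ᵐᵒᵖ = 4 := by
    rw [← (MulOpposite.opLinearEquiv ℝ : Quaternion ℝ ≃ₗ[ℝ] _).finrank_eq,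
      Quaternion.finrank_eq_four]
  have := Module.finrank_mul_finrank ℝ (Quaternion ℝ)ᵐᵒᵖ (qEig A μ)
  rw [h4] at this
  exact ⟨_, this.symm⟩

theorem stmt_19 (n : ℕ) (A : Matrix (Fin n) (Fin n) (Quaternion ℝ))
    (hA : A.IsHermitian) :
    ∃ p : Polynomial ℝ, p.Monic ∧ p.natDegree = n ∧ (Iq A).charpoly = p ^ 4 := by
  have hc : (Iq A).charpoly = (qMul A).charpoly := by
    rw [← LinearEquiv.charpoly_conj (qCoord n) (qMul A), ← Iq_eq, Matrix.charpoly_toLin']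
  obtain ⟨p, hp, h⟩ := exists_fourth_root (Iq A).charpoly (Matrix.charpoly_monic _)
    (Iq_herm A hA).splits_charpoly (fun μ => hc ▸ dvd_mult A μ)
  refine ⟨p, hp, ?_, h⟩
  have := congrArg Polynomial.natDegree h
  rw [Matrix.charpoly_natDegree_eq_dim, hp.natDegree_pow] at this
  simp at this
  omega
end
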